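/- arXiv:1806.00410 — 2 statements merged into one kernel-verified Lean document; each statement's English description precedes it below -/
import Mathlib

section
/- A $d$-tuple $X$ of $n\times n$ matrices is pure (meaning $\Psi_X^k(I) \to 0$ as $k \to \infty$, where $\Psi_X(T) = \sum_j X_j T X_j^*$) if and only if $X$ is jointly similar to a strict row contraction. -/
open scoped Matrix ComplexOrder

/-- The completely positive map `Ψ_X(T) = ∑ⱼ Xⱼ T Xⱼ*` associated to a `d`-tuple of matrices. -/
noncomputable def Psi {d n : ℕ} (X : Fin d → Matrix (Fin n) (Fin n) ℂ)
    (T : Matrix (Fin n) (Fin n) ℂ) : Matrix (Fin n) (Fin n) ℂ :=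
  ∑ j, X j * T * (X j)ᴴ

open scoped Matrix.Norms.L2Operator MatrixOrder

section CStarAlgebra

variable {A : Type*} [CStarAlgebra A] [PartialOrder A] [StarOrderedRing A]

theorem IsStrictlyPositive.exists_one_le_and_le_smul {a b : A} (ha : IsStrictlyPositive a)
    (hb : IsSelfAdjoint b) : ∃ M : ℝ, 1 ≤ M ∧ b ≤ M • a := by
  rcases subsingleton_or_nontrivial A with _ | _
  · exact ⟨1, le_rfl, (Subsingleton.elim _ _).le⟩
  obtain ⟨r, hr, hra⟩ :=
    (CFC.exists_pos_algebraMap_le_iff ha.isSelfAdjoint).2 fun x hx ↦ ha.spectrum_pos hx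
  refine ⟨‖b‖ / r + 1, le_add_of_nonneg_left (by positivity), ?_⟩
  calc b ≤ algebraMap ℝ A ‖b‖ := hb.le_algebraMap_norm_self
    _ = (‖b‖ / r) • algebraMap ℝ A r := by
      rw [Algebra.algebraMap_eq_smul_one, Algebra.algebraMap_eq_smul_one, smul_smul,
        div_mul_cancel₀ _ hr.ne']
    _ ≤ (‖b‖ / r) • a := smul_le_smul_of_nonneg_left hra (by positivity)
    _ ≤ (‖b‖ / r + 1) • a := by
      rw [add_smul, one_smul]
      exact le_add_of_nonneg_right ha.nonneg

theorem IsSelfAdjoint.isStrictlyPositive_one_sub_of_norm_lt_one {a : A} (ha : IsSelfAdjoint a)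
    (h : ‖a‖ < 1) : IsStrictlyPositive (1 - a) := by
  have hpos : IsStrictlyPositive ((1 - ‖a‖) • (1 : A)) :=
    isStrictlyPositive_one.smul (sub_pos.2 h)
  refine hpos.of_le ?_
  rw [sub_smul, one_smul, ← Algebra.algebraMap_eq_smul_one]
  exact sub_le_sub_left ha.le_algebraMap_norm_self 1

end CStarAlgebra

section Psi

variable {d n : ℕ} (X : Fin d → Matrix (Fin n) (Fin n) ℂ)

theorem Psi_mono : Monotone (Psi X) := fun _ _ h ↦
  Finset.sum_le_sum fun j _ ↦ star_right_conjugate_le_conjugate h (X j)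

theorem Psi_zero : Psi X 0 = 0 := by simp [Psi]

theorem Psi_smul (c : ℝ) (T : Matrix (Fin n) (Fin n) ℂ) : Psi X (c • T) = c • Psi X T := by
  simp [Psi, Finset.smul_sum]

theorem Psi_sum {ι : Type*} (s : Finset ι) (T : ι → Matrix (Fin n) (Fin n) ℂ) :
    Psi X (∑ i ∈ s, T i) = ∑ i ∈ s, Psi X (T i) := by
  simp only [Psi, Finset.mul_sum, Finset.sum_mul]
  exact Finset.sum_comm

theorem Psi_iterate_nonneg {T : Matrix (Fin n) (Fin n) ℂ} (hT : 0 ≤ T) (k : ℕ) :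
    0 ≤ (Psi X)^[k] T := by
  simpa only [Function.iterate_fixed (Psi_zero X)] using (Psi_mono X).iterate k hT

theorem Psi_iterate_smul (c : ℝ) (T : Matrix (Fin n) (Fin n) ℂ) (k : ℕ) :
    (Psi X)^[k] (c • T) = c • (Psi X)^[k] T :=
  (Function.Commute.iterate_left (fun T ↦ Psi_smul X c T) k) T

theorem Psi_iterate_le_pow_smul {Q : Matrix (Fin n) (Fin n) ℂ} {c : ℝ} (hc : 0 ≤ c)
    (h : Psi X Q ≤ c • Q) (k : ℕ) : (Psi X)^[k] Q ≤ c ^ k • Q := by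
  induction k with
  | zero => simp
  | succ k ih =>
    rw [Function.iterate_succ_apply']
    calc Psi X ((Psi X)^[k] Q) ≤ Psi X (c ^ k • Q) := Psi_mono X ih
      _ = c ^ k • Psi X Q := Psi_smul X _ _
      _ ≤ c ^ k • c • Q := smul_le_smul_of_nonneg_left h (by positivity)
      _ = c ^ (k + 1) • Q := by rw [smul_smul, pow_succ]

/-- The tuple `S⁻¹ X S` is a strict row contraction iff `Q = S S*` satisfies `Ψ_X(Q) < Q`. -/
theorem posDef_one_sub_sum_conj_iff {S : Matrix (Fin n) (Fin n) ℂ} (hS : IsUnit S) :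
    (1 - ∑ j, (S⁻¹ * X j * S) * (S⁻¹ * X j * S)ᴴ).PosDef ↔
      (S * Sᴴ - Psi X (S * Sᴴ)).PosDef := by
  have hS' := (Matrix.isUnit_iff_isUnit_det S).1 hS
  have hSl : S * S⁻¹ = 1 := Matrix.mul_nonsing_inv S hS'
  have hSr : (S⁻¹)ᴴ * Sᴴ = 1 := by
    rw [← Matrix.conjTranspose_mul, hSl, Matrix.conjTranspose_one]
  rw [← Matrix.IsUnit.posDef_star_right_conjugate_iff hS]
  congr! 1
  rw [Matrix.star_eq_conjTranspose, mul_sub, sub_mul, mul_one, Finset.mul_sum, Finset.sum_mul, Psi]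
  congr! 2 with j
  calc S * (S⁻¹ * X j * S * (S⁻¹ * X j * S)ᴴ) * Sᴴ
      = (S * S⁻¹) * X j * S * Sᴴ * (X j)ᴴ * ((S⁻¹)ᴴ * Sᴴ) := by
        simp only [Matrix.conjTranspose_mul, mul_assoc]
    _ = X j * (S * Sᴴ) * (X j)ᴴ := by
        rw [hSl, hSr]
        simp only [one_mul, mul_one, mul_assoc]

theorem exists_similar_strict_row_contraction_iff :
    (∃ S : Matrix (Fin n) (Fin n) ℂ, IsUnit S ∧
      (1 - ∑ j, (S⁻¹ * X j * S) * (S⁻¹ * X j * S)ᴴ).PosDef) ↔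
    ∃ Q : Matrix (Fin n) (Fin n) ℂ, IsStrictlyPositive Q ∧ IsStrictlyPositive (Q - Psi X Q) := by
  constructor
  · rintro ⟨S, hS, h⟩
    exact ⟨S * Sᴴ, CStarAlgebra.isStrictlyPositive_iff_eq_mul_star_self.2 ⟨S, hS, rfl⟩,
      ((posDef_one_sub_sum_conj_iff X hS).1 h).isStrictlyPositive⟩
  · rintro ⟨Q, hQ, h⟩
    obtain ⟨S, hS, rfl⟩ := CStarAlgebra.isStrictlyPositive_iff_eq_mul_star_self.1 hQ
    exact ⟨S, hS, (posDef_one_sub_sum_conj_iff X hS).2 (Matrix.isStrictlyPositive_iff_posDef.1 h)⟩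

theorem exists_isStrictlyPositive_sub_Psi
    (h : Filter.Tendsto (fun k => (Psi X)^[k] 1) Filter.atTop (nhds 0)) :
    ∃ Q : Matrix (Fin n) (Fin n) ℂ, IsStrictlyPositive Q ∧ IsStrictlyPositive (Q - Psi X Q) := by
  have hnonneg (k : ℕ) : 0 ≤ (Psi X)^[k] 1 := Psi_iterate_nonneg X zero_le_one k
  obtain ⟨m, hm, hm0⟩ :=
    (((tendsto_zero_iff_norm_tendsto_zero.1 h).eventually_lt_const zero_lt_one).and
      (Filter.eventually_gt_atTop 0)).exists
  refine ⟨∑ k ∈ Finset.range m, (Psi X)^[k] 1, ?_, ?_⟩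
  · exact isStrictlyPositive_one.of_le <|
      Finset.single_le_sum (f := fun k ↦ (Psi X)^[k] 1) (fun k _ ↦ hnonneg k)
        (Finset.mem_range.2 hm0)
  · have htele : ∑ k ∈ Finset.range m, (Psi X)^[k] 1 - Psi X (∑ k ∈ Finset.range m, (Psi X)^[k] 1)
        = 1 - (Psi X)^[m] 1 := by
      simp only [Psi_sum, ← Function.iterate_succ_apply' (Psi X), ← Finset.sum_sub_distrib]
      exact Finset.sum_range_sub' (fun k ↦ (Psi X)^[k] 1) m
    rw [htele]
    exact (IsSelfAdjoint.of_nonneg (hnonneg m)).isStrictlyPositive_one_sub_of_norm_lt_one hm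

theorem tendsto_Psi_iterate_of_isStrictlyPositive_sub {Q : Matrix (Fin n) (Fin n) ℂ}
    (hQ : IsStrictlyPositive Q) (h : IsStrictlyPositive (Q - Psi X Q)) :
    Filter.Tendsto (fun k => (Psi X)^[k] 1) Filter.atTop (nhds 0) := by
  obtain ⟨M, hM, hQM⟩ := h.exists_one_le_and_le_smul hQ.isSelfAdjoint
  obtain ⟨L, hL, hQL⟩ := hQ.exists_one_le_and_le_smul (IsSelfAdjoint.one _)
  have hM0 : 0 < M := by linarith
  have hc : 0 ≤ 1 - M⁻¹ := sub_nonneg.2 (inv_le_one_of_one_le₀ hM)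
  have hc1 : 1 - M⁻¹ < 1 := sub_lt_self 1 (inv_pos.2 hM0)
  have hPsi : Psi X Q ≤ (1 - M⁻¹) • Q := by
    rw [sub_smul, one_smul, le_sub_comm]
    calc M⁻¹ • Q ≤ M⁻¹ • M • (Q - Psi X Q) :=
          smul_le_smul_of_nonneg_left hQM (inv_nonneg.2 hM0.le)
      _ = Q - Psi X Q := inv_smul_smul₀ hM0.ne' _
  have hbound (k : ℕ) : (Psi X)^[k] 1 ≤ L • (1 - M⁻¹) ^ k • Q :=
    calc (Psi X)^[k] 1 ≤ (Psi X)^[k] (L • Q) := (Psi_mono X).iterate k hQL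
      _ = L • (Psi X)^[k] Q := Psi_iterate_smul X L Q k
      _ ≤ L • (1 - M⁻¹) ^ k • Q :=
        smul_le_smul_of_nonneg_left (Psi_iterate_le_pow_smul X hc hPsi k) (by linarith)
  have hlim : Filter.Tendsto (fun k ↦ L • (1 - M⁻¹) ^ k • Q) Filter.atTop (nhds 0) := by
    simpa using ((tendsto_pow_atTop_nhds_zero_of_lt_one hc hc1).smul_const Q).const_smul L
  exact squeeze_zero_norm (fun k ↦ CStarAlgebra.norm_le_norm_of_nonneg_of_le
    (Psi_iterate_nonneg X zero_le_one k) (hbound k)) (tendsto_zero_iff_norm_tendsto_zero.1 hlim)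

end Psi

/-- A `d`-tuple `X` is pure (`Ψ_X^k(I) → 0`) iff it is jointly similar to a strict row
contraction. -/
theorem stmt_2 {d n : ℕ} (X : Fin d → Matrix (Fin n) (Fin n) ℂ) :
    Filter.Tendsto (fun k => (Psi X)^[k] 1) Filter.atTop (nhds 0) ↔
    ∃ S : Matrix (Fin n) (Fin n) ℂ, IsUnit S ∧
      (1 - ∑ j, (S⁻¹ * X j * S) * (S⁻¹ * X j * S)ᴴ).PosDef := by
  rw [exists_similar_strict_row_contraction_iff]
  exact ⟨exists_isStrictlyPositive_sub_Psi X,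
    fun ⟨_, hQ, h⟩ ↦ tendsto_Psi_iterate_of_isStrictlyPositive_sub X hQ h⟩
end

section
/- Let $\Theta$ be a positive, irreducible linear map on $M_n(\mathbb{C})$ with spectral radius $r$. Then $r$ is an eigenvalue of $\Theta$ of algebraic multiplicity $1$ (i.e., $r$ is a simple eigenvalue of $\Theta$ as a linear operator on $M_n$). -/
open scoped Matrix ComplexOrder

/-- A linear map `Θ` on `Mₙ(ℂ)` is irreducible (in the Evans–Høegh-Krohn sense) if the only
orthogonal projections `P` with `Θ(P Mₙ P) ⊆ P Mₙ P` are `0` and `1`. -/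
def IrreduciblePosMap {n : ℕ}
    (Θ : Matrix (Fin n) (Fin n) ℂ →ₗ[ℂ] Matrix (Fin n) (Fin n) ℂ) : Prop :=
  ∀ P : Matrix (Fin n) (Fin n) ℂ, P.IsHermitian → P * P = P →
    (∀ T : Matrix (Fin n) (Fin n) ℂ, Θ (P * T * P) = P * Θ (P * T * P) * P) →
    P = 0 ∨ P = 1

namespace Matrix

/-- The real quadratic form `v ↦ Re (v* A v)` of a complex matrix. -/
noncomputable def reQuad {n : ℕ} (A : Matrix (Fin n) (Fin n) ℂ) (v : Fin n → ℂ) : ℝ :=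
  (star v ⬝ᵥ (A *ᵥ v)).re

section reQuad

variable {n : ℕ} {A B X Y : Matrix (Fin n) (Fin n) ℂ}

lemma reQuad_sub (v : Fin n → ℂ) : reQuad (A - B) v = reQuad A v - reQuad B v := by
  simp [reQuad, sub_mulVec]

lemma reQuad_add (v : Fin n → ℂ) : reQuad (A + B) v = reQuad A v + reQuad B v := by
  simp [reQuad, add_mulVec]

lemma reQuad_smul (c : ℝ) (v : Fin n → ℂ) : reQuad ((c : ℂ) • A) v = c * reQuad A v := by
  simp [reQuad, smul_mulVec]

lemma dotProduct_mulVec_conjTranspose (A : Matrix (Fin n) (Fin n) ℂ) (v : Fin n → ℂ) :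
    star v ⬝ᵥ (Aᴴ *ᵥ v) = star (star v ⬝ᵥ (A *ᵥ v)) := by
  rw [star_dotProduct, star_mulVec, ← dotProduct_mulVec, conjTranspose_conjTranspose]

lemma reQuad_conjTranspose (v : Fin n → ℂ) : reQuad Aᴴ v = reQuad A v := by
  rw [reQuad, dotProduct_mulVec_conjTranspose, reQuad]
  simp

lemma continuous_dotProduct_mulVec (A : Matrix (Fin n) (Fin n) ℂ) :
    Continuous fun v : Fin n → ℂ => star v ⬝ᵥ (A *ᵥ v) := by
  fun_prop

lemma dotProduct_mulVec_smul (A : Matrix (Fin n) (Fin n) ℂ) (c : ℂ) (v : Fin n → ℂ) :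
    star (c • v) ⬝ᵥ (A *ᵥ (c • v)) = ((‖c‖ ^ 2 : ℝ) : ℂ) * (star v ⬝ᵥ (A *ᵥ v)) := by
  have : star c * c = ((‖c‖ ^ 2 : ℝ) : ℂ) := by
    simpa using Complex.conj_mul' c
  simp only [star_smul, mulVec_smul, smul_dotProduct, dotProduct_smul, smul_eq_mul]
  rw [← this]
  ring

lemma reQuad_vec_smul (A : Matrix (Fin n) (Fin n) ℂ) (c : ℂ) (v : Fin n → ℂ) :
    reQuad A (c • v) = ‖c‖ ^ 2 * reQuad A v := by
  rw [reQuad, dotProduct_mulVec_smul, Complex.re_ofReal_mul, reQuad]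

lemma posSemidef_iff_reQuad_nonneg :
    A.PosSemidef ↔ A.IsHermitian ∧ ∀ v, 0 ≤ reQuad A v := by
  rw [posSemidef_iff_dotProduct_mulVec]
  refine and_congr_right fun hA => forall_congr' fun v => ?_
  rw [Complex.nonneg_iff]
  exact and_iff_left (hA.im_star_dotProduct_mulVec_self v).symm

lemma PosDef.reQuad_pos (hX : X.PosDef) {v : Fin n → ℂ} (hv : v ≠ 0) : 0 < reQuad X v :=
  hX.re_dotProduct_pos hv

lemma PosSemidef.reQuad_nonneg (hX : X.PosSemidef) (v : Fin n → ℂ) : 0 ≤ reQuad X v :=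
  hX.re_dotProduct_nonneg v

lemma PosSemidef.eq_zero_of_neg (hX : X.PosSemidef) (hX' : (-X).PosSemidef) : X = 0 := by
  have h1 := hX.trace_nonneg
  have h2 := hX'.trace_nonneg
  rw [trace_neg] at h2
  exact hX.trace_eq_zero_iff.1 (le_antisymm (by simpa using h2) h1)

/-- A real quadratic form attains its supremum relative to a positive definite one. -/
lemma PosDef.exists_isMax_ratio (hn : 0 < n) (hX : X.PosDef) {f : (Fin n → ℂ) → ℝ}
    (hf : Continuous f) (hsmul : ∀ (c : ℂ) v, f (c • v) = ‖c‖ ^ 2 * f v) :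
    ∃ (t : ℝ) (v : Fin n → ℂ), v ≠ 0 ∧ f v = t * reQuad X v ∧ ∀ w, f w ≤ t * reQuad X w := by
  have : Nonempty (Fin n) := ⟨⟨0, hn⟩⟩
  have hne : (Metric.sphere (0 : Fin n → ℂ) 1).Nonempty := NormedSpace.sphere_nonempty.2 zero_le_one
  have hs0 : ∀ v ∈ Metric.sphere (0 : Fin n → ℂ) 1, v ≠ 0 := by
    rintro v hv rfl
    simp at hv
  have hXc : Continuous (reQuad X) := Complex.continuous_re.comp (continuous_dotProduct_mulVec X)
  obtain ⟨v, hv, hmax⟩ := (isCompact_sphere (0 : Fin n → ℂ) 1).exists_isMaxOn hne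
    (f := fun v => f v / reQuad X v)
    (hf.continuousOn.div hXc.continuousOn fun v hv => (hX.reQuad_pos (hs0 v hv)).ne')
  refine ⟨f v / reQuad X v, v, hs0 v hv, ?_, fun w => ?_⟩
  · exact (div_mul_cancel₀ _ (hX.reQuad_pos (hs0 v hv)).ne').symm
  · by_cases hw : w = 0
    · have := hsmul 0 0
      subst hw
      simp_all [reQuad]
    · have hw' : ‖w‖ ≠ 0 := norm_ne_zero_iff.2 hw
      set u : Fin n → ℂ := ((‖w‖⁻¹ : ℝ) : ℂ) • w with hu
      have hu1 : u ∈ Metric.sphere (0 : Fin n → ℂ) 1 := by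
        simp [hu, norm_smul, hw']
      have hwu : w = ((‖w‖ : ℝ) : ℂ) • u := by
        rw [hu, smul_smul, ← Complex.ofReal_mul, mul_inv_cancel₀ hw']
        simp
      have key := (div_le_iff₀ (hX.reQuad_pos (hs0 u hu1))).1 (hmax hu1)
      rw [hwu, hsmul, reQuad_vec_smul]
      have : 0 ≤ ‖((‖w‖ : ℝ) : ℂ)‖ ^ 2 := by positivity
      calc _ ≤ ‖((‖w‖ : ℝ) : ℂ)‖ ^ 2 * _ := mul_le_mul_of_nonneg_left key this
        _ = _ := by ring

/-- The smallest multiple of a positive definite `X` dominating a Hermitian `Y` touches `Y`. -/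
lemma PosDef.exists_smul_sub_posSemidef (hn : 0 < n) (hX : X.PosDef) (hY : Y.IsHermitian) :
    ∃ (t : ℝ) (v : Fin n → ℂ), v ≠ 0 ∧ ((t : ℂ) • X - Y).PosSemidef ∧
      reQuad Y v = t * reQuad X v := by
  obtain ⟨t, v, hv, h1, h2⟩ := hX.exists_isMax_ratio hn (f := reQuad Y)
    (Complex.continuous_re.comp (continuous_dotProduct_mulVec Y)) (reQuad_vec_smul Y)
  refine ⟨t, v, hv, posSemidef_iff_reQuad_nonneg.2 ⟨?_, fun w => ?_⟩, h1⟩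
  · exact (hX.1.smul (by simp [IsSelfAdjoint])).sub hY
  · rw [reQuad_sub, reQuad_smul]
    linarith [h2 w]

lemma eq_zero_of_forall_dotProduct_mulVec_eq_zero (h : ∀ v, star v ⬝ᵥ (A *ᵥ v) = 0) : A = 0 := by
  have hH : ∀ v, star v ⬝ᵥ (Aᴴ *ᵥ v) = 0 := fun v => by
    rw [dotProduct_mulVec_conjTranspose, h, star_zero]
  have key : ∀ B : Matrix (Fin n) (Fin n) ℂ, B.IsHermitian →
      (∀ v, star v ⬝ᵥ (B *ᵥ v) = 0) → B = 0 := fun B hB hq =>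
    PosSemidef.eq_zero_of_neg
      (.of_dotProduct_mulVec_nonneg hB fun v => (hq v).ge)
      (.of_dotProduct_mulVec_nonneg hB.neg fun v => by simp [neg_mulVec, hq v])
  have h1 : A + Aᴴ = 0 := key _ (by simp [IsHermitian, add_comm]) fun v => by
    simp [add_mulVec, h, hH]
  have h2 : Complex.I • (A - Aᴴ) = 0 := key _ (by simp [IsHermitian, ← smul_neg]) fun v => by
    simp [sub_mulVec, smul_mulVec, h, hH]
  have h3 : A = Aᴴ := sub_eq_zero.1 ((smul_eq_zero.1 h2).resolve_left Complex.I_ne_zero)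
  rw [← h3, ← two_smul ℂ] at h1
  exact (smul_eq_zero.1 h1).resolve_left two_ne_zero

end reQuad

variable {n : ℕ}

lemma mem_of_forall_isHermitian_mem {p : Submodule ℂ (Matrix (Fin n) (Fin n) ℂ)}
    (h : ∀ Y : Matrix (Fin n) (Fin n) ℂ, Y.IsHermitian → Y ∈ p)
    (A : Matrix (Fin n) (Fin n) ℂ) : A ∈ p := by
  have h1 : A + Aᴴ ∈ p := h _ (by simp [IsHermitian, add_comm])
  have h2 : Complex.I • (A - Aᴴ) ∈ p := h _ (by simp [IsHermitian, ← smul_neg])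
  have h3 : (2 : ℂ)⁻¹ • ((A + Aᴴ) + (-Complex.I) • Complex.I • (A - Aᴴ)) ∈ p :=
    p.smul_mem _ (p.add_mem h1 (p.smul_mem _ h2))
  convert h3 using 1
  rw [smul_smul, neg_mul, Complex.I_mul_I, neg_neg, one_smul, add_add_sub_cancel, ← two_smul ℂ A,
    smul_smul, inv_mul_cancel₀ two_ne_zero, one_smul]

lemma mem_of_forall_posSemidef_mem (hn : 0 < n) {p : Submodule ℂ (Matrix (Fin n) (Fin n) ℂ)}
    (h : ∀ Y : Matrix (Fin n) (Fin n) ℂ, Y.PosSemidef → Y ∈ p)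
    (A : Matrix (Fin n) (Fin n) ℂ) : A ∈ p := by
  refine mem_of_forall_isHermitian_mem (fun Y hY => ?_) A
  obtain ⟨t, -, -, ht, -⟩ := PosDef.one.exists_smul_sub_posSemidef hn hY
  rw [← sub_sub_cancel ((t : ℂ) • (1 : Matrix (Fin n) (Fin n) ℂ)) Y]
  exact p.sub_mem (p.smul_mem _ (h _ .one)) (h _ ht)

/-- A positive semidefinite matrix has a Hermitian square root `S`, with a Hermitian
pseudo-inverse `G` such that `S * G = G * S` is the projection onto its range. -/
lemma PosSemidef.exists_sqrt_pseudoinverse {X : Matrix (Fin n) (Fin n) ℂ} (hX : X.PosSemidef) :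
    ∃ S G : Matrix (Fin n) (Fin n) ℂ, S.IsHermitian ∧ G.IsHermitian ∧ S * S = X ∧
      G * S = S * G ∧ S * G * S = S := by
  set φ := Unitary.conjStarAlgAut ℂ _ hX.1.eigenvectorUnitary
  set s : Fin n → ℝ := fun i => √(hX.1.eigenvalues i)
  refine ⟨φ (diagonal fun i => (s i : ℂ)), φ (diagonal fun i => ((s i)⁻¹ : ℂ)), ?_, ?_, ?_, ?_, ?_⟩
  · rw [IsHermitian, ← star_eq_conjTranspose, ← map_star, star_eq_conjTranspose,
      diagonal_conjTranspose]
    congr 2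
    ext i
    simp
  · rw [IsHermitian, ← star_eq_conjTranspose, ← map_star, star_eq_conjTranspose,
      diagonal_conjTranspose]
    congr 2
    ext i
    simp
  · conv_rhs => rw [hX.1.spectral_theorem]
    rw [← map_mul, diagonal_mul_diagonal]
    congr 2
    ext i
    simp only [Function.comp_apply, s]
    rw [← Complex.ofReal_mul, Real.mul_self_sqrt (hX.eigenvalues_nonneg i)]
    rfl
  · rw [← map_mul, ← map_mul, diagonal_mul_diagonal, diagonal_mul_diagonal]
    simp only [mul_comm]
  · rw [← map_mul, ← map_mul, diagonal_mul_diagonal, diagonal_mul_diagonal]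
    simp only [mul_inv_mul_cancel]

lemma PosSemidef.mul_eq_zero_of_conj_eq_zero {M Q : Matrix (Fin n) (Fin n) ℂ}
    (hM : M.PosSemidef) (h : Qᴴ * M * Q = 0) : M * Q = 0 := by
  obtain ⟨S, -, hS, -, rfl, -⟩ := hM.exists_sqrt_pseudoinverse
  have : (S * Q)ᴴ * (S * Q) = 0 := by
    rw [conjTranspose_mul, hS.eq, ← h]
    simp only [mul_assoc]
  rw [mul_assoc, conjTranspose_mul_self_eq_zero.1 this, mul_zero]

end Matrix

section PositiveMap

open Matrix

variable {n : ℕ} {Θ : Module.End ℂ (Matrix (Fin n) (Fin n) ℂ)}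

lemma map_isHermitian_of_map_posSemidef (hn : 0 < n)
    (hpos : ∀ T : Matrix (Fin n) (Fin n) ℂ, T.PosSemidef → (Θ T).PosSemidef)
    {Y : Matrix (Fin n) (Fin n) ℂ} (hY : Y.IsHermitian) : (Θ Y).IsHermitian := by
  obtain ⟨t, -, -, ht, -⟩ := PosDef.one.exists_smul_sub_posSemidef hn hY
  rw [← sub_sub_cancel ((t : ℂ) • (1 : Matrix (Fin n) (Fin n) ℂ)) Y, map_sub, map_smul]
  exact ((hpos _ .one).1.smul (by simp [IsSelfAdjoint])).sub (hpos _ ht).1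

lemma map_conjTranspose_of_map_posSemidef (hn : 0 < n)
    (hpos : ∀ T : Matrix (Fin n) (Fin n) ℂ, T.PosSemidef → (Θ T).PosSemidef)
    (A : Matrix (Fin n) (Fin n) ℂ) : Θ Aᴴ = (Θ A)ᴴ := by
  have h1 := map_isHermitian_of_map_posSemidef hn hpos (Y := A + Aᴴ)
    (by simp [IsHermitian, add_comm])
  have h2 := map_isHermitian_of_map_posSemidef hn hpos (Y := Complex.I • (A - Aᴴ))
    (by simp [IsHermitian, ← smul_neg])
  simp only [IsHermitian, map_add, map_smul, map_sub, conjTranspose_add, conjTranspose_smul,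
    conjTranspose_sub, RCLike.star_def, Complex.conj_I, neg_smul, ← smul_neg] at h1 h2
  have h3 := smul_right_injective _ Complex.I_ne_zero h2
  have h4 : (2 : ℂ) • Θ Aᴴ = (2 : ℂ) • (Θ A)ᴴ := by
    rw [two_smul, two_smul]
    linear_combination (norm := module) h3 - h1
  exact smul_right_injective _ two_ne_zero h4

/-- For an irreducible positive map, a nonzero subinvariant positive semidefinite matrix is
positive definite. -/
lemma IrreduciblePosMap.posDef_of_subinvariant (hn : 0 < n)
    (hpos : ∀ T : Matrix (Fin n) (Fin n) ℂ, T.PosSemidef → (Θ T).PosSemidef)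
    (hirr : IrreduciblePosMap Θ) {X : Matrix (Fin n) (Fin n) ℂ} (hX : X.PosSemidef)
    (hX0 : X ≠ 0) {c : ℝ} (hc : ((c : ℂ) • X - Θ X).PosSemidef) : X.PosDef := by
  obtain ⟨S, G, hS, hG, hSX, hGS, hSGS⟩ := hX.exists_sqrt_pseudoinverse
  have hP : (S * G).IsHermitian := by
    rw [IsHermitian, conjTranspose_mul, hS.eq, hG.eq, hGS]
  set Q := 1 - S * G with hQ
  have hQH : Qᴴ = Q := by rw [hQ, conjTranspose_sub, conjTranspose_one, hP.eq]
  have hQS : Q * S = 0 := by rw [hQ, sub_mul, one_mul, hSGS, sub_self]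
  have hQX : Q * X = 0 := by rw [← hSX, ← mul_assoc, hQS, zero_mul]
  have hmem : ∀ T, Θ (S * T * S) * Q = 0 := by
    refine mem_of_forall_posSemidef_mem hn (p := LinearMap.ker
      (LinearMap.mulRight ℂ Q ∘ₗ Θ ∘ₗ LinearMap.mulLeftRight ℂ (S, S))) fun T hT => ?_
    change Θ (S * T * S) * Q = 0
    obtain ⟨t, v, hv, ht, htv⟩ := PosDef.one.exists_smul_sub_posSemidef hn hT.1
    have ht0 : 0 ≤ t := by
      have h1 := PosDef.one.reQuad_pos hv
      have h2 := hT.reQuad_nonneg v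
      rw [htv] at h2
      exact nonneg_of_mul_nonneg_left h2 h1
    have hSTS : (S * T * S).PosSemidef := by
      simpa [hS.eq] using hT.conjTranspose_mul_mul_same S
    have hdom : ((t : ℂ) • X - S * T * S).PosSemidef := by
      simpa [hS.eq, mul_sub, sub_mul, hSX] using ht.conjTranspose_mul_mul_same S
    have hdom' : (((t * c : ℝ) : ℂ) • X - Θ (S * T * S)).PosSemidef := by
      have := (hc.smul (a := (t : ℂ)) (by exact_mod_cast ht0)).add (hpos _ hdom)
      rwa [map_sub, map_smul, smul_sub, smul_smul, ← Complex.ofReal_mul, sub_add_sub_cancel] at this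
    refine (hpos _ hSTS).mul_eq_zero_of_conj_eq_zero
      (((hpos _ hSTS).conjTranspose_mul_mul_same Q).eq_zero_of_neg ?_)
    simpa [hQH, mul_sub, sub_mul, hQX] using hdom'.conjTranspose_mul_mul_same Q
  have hmem' : ∀ T, Q * Θ (S * T * S) = 0 := fun T => by
    have := congrArg conjTranspose (hmem Tᴴ)
    rwa [conjTranspose_mul, ← map_conjTranspose_of_map_posSemidef hn hpos, conjTranspose_mul,
      conjTranspose_mul, conjTranspose_conjTranspose, hS.eq, hQH, conjTranspose_zero,
      ← mul_assoc] at this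
  have hinv : ∀ T, Θ (S * G * T * (S * G)) = S * G * Θ (S * G * T * (S * G)) * (S * G) := by
    intro T
    have e : S * G * T * (S * G) = S * (G * T * G) * S := by
      rw [← hGS]
      nth_rewrite 1 [hGS]
      simp only [mul_assoc]
    have hPQ : S * G = 1 - Q := by simp [hQ]
    rw [e, hPQ, sub_mul, one_mul, hmem', sub_zero, mul_sub, mul_one, hmem, sub_zero]
  rcases hirr (S * G) hP (by rw [← mul_assoc, hSGS]) hinv with h | h
  · rw [h, zero_mul] at hSGS
    exact absurd (by rw [← hSX, ← hSGS, zero_mul]) hX0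
  · refine hX.posDef_iff_isUnit.2 ?_
    have : IsUnit S := .of_mul_eq_one G h
    rw [← hSX]
    exact this.mul this

lemma norm_le_of_subinvariant (hn : 0 < n)
    (hpos : ∀ T : Matrix (Fin n) (Fin n) ℂ, T.PosSemidef → (Θ T).PosSemidef)
    {X : Matrix (Fin n) (Fin n) ℂ} (hX : X.PosDef) {r : ℝ}
    (hr : ((r : ℂ) • X - Θ X).PosSemidef) {Y : Matrix (Fin n) (Fin n) ℂ} (hY : Y ≠ 0) {μ : ℂ}
    (hμ : Θ Y = μ • Y) : ‖μ‖ ≤ r := by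
  obtain ⟨t, v, hv, h1, h2⟩ := hX.exists_isMax_ratio hn (f := fun v => ‖star v ⬝ᵥ (Y *ᵥ v)‖)
    (continuous_dotProduct_mulVec Y).norm fun c v => by
      rw [dotProduct_mulVec_smul, norm_mul, Complex.norm_real, Real.norm_of_nonneg (by positivity)]
  have hXv := hX.reQuad_pos hv
  have ht : 0 < t := by
    by_contra! ht
    refine hY (eq_zero_of_forall_dotProduct_mulVec_eq_zero fun w => norm_le_zero_iff.1 ?_)
    exact (h2 w).trans (mul_nonpos_of_nonpos_of_nonneg ht (hX.posSemidef.reQuad_nonneg w))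
  set z := μ * (star v ⬝ᵥ (Y *ᵥ v)) with hz
  set θ : ℂ := (starRingEnd ℂ) z / ‖z‖ with hθ
  have hθ1 : ‖θ‖ ≤ 1 := by
    simp only [hθ, norm_div, RCLike.norm_conj, Complex.norm_real, norm_norm]
    exact div_self_le_one _
  have hθz : (θ * z).re = ‖z‖ := by
    rw [hθ, div_mul_eq_mul_div, Complex.conj_mul', pow_two, mul_self_div_self, Complex.ofReal_re]
  have hquad : ∀ (c : ℂ) w, reQuad (c • Y + (c • Y)ᴴ) w = 2 * (c * (star w ⬝ᵥ (Y *ᵥ w))).re := by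
    intro c w
    rw [reQuad_add, reQuad_conjTranspose, ← two_mul, reQuad, smul_mulVec, dotProduct_smul,
      smul_eq_mul]
  have hA : (((2 * t : ℝ) : ℂ) • X - (θ • Y + (θ • Y)ᴴ)).PosSemidef := by
    refine posSemidef_iff_reQuad_nonneg.2 ⟨?_, fun w => ?_⟩
    · exact (hX.1.smul (by simp [IsSelfAdjoint])).sub (by simp [IsHermitian, add_comm])
    · rw [reQuad_sub, reQuad_smul, hquad]
      have h3 : (θ * (star w ⬝ᵥ (Y *ᵥ w))).re ≤ ‖star w ⬝ᵥ (Y *ᵥ w)‖ := by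
        refine (Complex.re_le_norm _).trans ?_
        rw [norm_mul]
        exact mul_le_of_le_one_left (norm_nonneg _) hθ1
      linarith [h2 w]
  have hΘA := (hpos _ hA).reQuad_nonneg v
  rw [map_sub, map_add, map_conjTranspose_of_map_posSemidef hn hpos, map_smul, map_smul, hμ,
    smul_smul, reQuad_sub, reQuad_smul, hquad, mul_assoc θ, ← hz, hθz, hz, norm_mul, h1] at hΘA
  have hrv := hr.reQuad_nonneg v
  rw [reQuad_sub, reQuad_smul] at hrv
  have h4 : ‖μ‖ * (t * reQuad X v) ≤ r * (t * reQuad X v) := by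
    have := mul_nonneg ht.le hrv
    nlinarith
  exact le_of_mul_le_mul_right h4 (mul_pos ht hXv)

/-- Above a subinvariance constant `r`, the resolvent of a positive map exists. -/
lemma exists_resolvent_of_subinvariant (hn : 0 < n)
    (hpos : ∀ T : Matrix (Fin n) (Fin n) ℂ, T.PosSemidef → (Θ T).PosSemidef)
    {X : Matrix (Fin n) (Fin n) ℂ} (hX : X.PosDef) {r t : ℝ}
    (hr : ((r : ℂ) • X - Θ X).PosSemidef) (ht : r < t) :
    ∃ e : Matrix (Fin n) (Fin n) ℂ ≃ₗ[ℂ] Matrix (Fin n) (Fin n) ℂ,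
      ∀ Y, e Y = (t : ℂ) • Y - Θ Y := by
  have hinj : Function.Injective ((t : ℂ) • 1 - Θ : Module.End ℂ (Matrix (Fin n) (Fin n) ℂ)) := by
    refine (injective_iff_map_eq_zero _).2 fun Y hY => ?_
    by_contra hY0
    have h := norm_le_of_subinvariant hn hpos hX hr hY0 (μ := t)
      (sub_eq_zero.1 hY).symm
    rw [Complex.norm_real] at h
    exact absurd ((le_abs_self t).trans h) ht.not_ge
  exact ⟨LinearEquiv.ofInjectiveEndo _ hinj, fun Y => rfl⟩

/-- Above a subinvariance constant `r`, the resolvent of a positive map is positive. -/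
lemma posSemidef_of_resolvent_posSemidef (hn : 0 < n)
    (hpos : ∀ T : Matrix (Fin n) (Fin n) ℂ, T.PosSemidef → (Θ T).PosSemidef)
    {X : Matrix (Fin n) (Fin n) ℂ} (hX : X.PosDef) {r t : ℝ}
    (hr : ((r : ℂ) • X - Θ X).PosSemidef) (ht : r < t) {Y : Matrix (Fin n) (Fin n) ℂ}
    (hY : ((t : ℂ) • Y - Θ Y).PosSemidef) : Y.PosSemidef := by
  have hYH : Y.IsHermitian := by
    obtain ⟨e, he⟩ := exists_resolvent_of_subinvariant hn hpos hX hr ht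
    refine e.injective ?_
    rw [he, he, map_conjTranspose_of_map_posSemidef hn hpos, ← hY.1.eq]
    simp
  obtain ⟨s, v, hv, hs, hsv⟩ := hX.exists_smul_sub_posSemidef hn hYH.neg
  rw [sub_neg_eq_add] at hs
  have hXv := hX.reQuad_pos hv
  have hs0 : s ≤ 0 := by
    by_contra! hs0
    have h1 := hY.reQuad_nonneg v
    have h2 := (hpos _ hs).reQuad_nonneg v
    have h3 := hr.reQuad_nonneg v
    have h4 : reQuad (-Y) v = -reQuad Y v := by
      rw [← zero_sub, reQuad_sub]
      simp [reQuad]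
    rw [map_add, map_smul, reQuad_add, reQuad_smul] at h2
    rw [reQuad_sub, reQuad_smul] at h1 h3
    have h5 := mul_nonneg hs0.le h3
    have h6 := mul_pos (mul_pos hs0 hXv) (sub_pos.2 ht)
    have h7 : t * reQuad Y v = -(t * (s * reQuad X v)) := by
      rw [← hsv, h4]
      ring
    nlinarith
  have := hs.add (hX.posSemidef.smul (a := ((-s : ℝ) : ℂ)) (by exact_mod_cast neg_nonneg.2 hs0))
  rw [Complex.ofReal_neg, neg_smul, add_comm, neg_add_cancel_left] at this
  exact this

lemma Matrix.isClosed_setOf_posSemidef :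
    IsClosed {A : Matrix (Fin n) (Fin n) ℂ | A.PosSemidef} := by
  simp only [posSemidef_iff_dotProduct_mulVec, IsHermitian, Set.ofPred_and, Set.ofPred_forall,
    Complex.nonneg_iff]
  refine (isClosed_eq (by fun_prop) continuous_id).inter (isClosed_iInter fun v => ?_)
  have hc : Continuous fun A : Matrix (Fin n) (Fin n) ℂ => star v ⬝ᵥ (A *ᵥ v) := by fun_prop
  exact (isClosed_le continuous_const (Complex.continuous_re.comp hc)).inter
    (isClosed_eq continuous_const (Complex.continuous_im.comp hc))

lemma nonneg_of_subinvariant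
    (hpos : ∀ T : Matrix (Fin n) (Fin n) ℂ, T.PosSemidef → (Θ T).PosSemidef)
    {X : Matrix (Fin n) (Fin n) ℂ} (hX : X.PosSemidef) (hX0 : X ≠ 0) {c : ℝ}
    (hc : ((c : ℂ) • X - Θ X).PosSemidef) : 0 ≤ c := by
  by_contra! h
  have h1 := hc.add (hpos _ hX)
  rw [sub_add_cancel] at h1
  have h2 := h1.smul (a := ((-c⁻¹ : ℝ) : ℂ))
    (by exact_mod_cast (neg_pos.2 (inv_lt_zero.2 h)).le)
  rw [smul_smul, ← Complex.ofReal_mul, neg_mul, inv_mul_cancel₀ h.ne, Complex.ofReal_neg,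
    Complex.ofReal_one, neg_one_smul] at h2
  exact hX0 (hX.eq_zero_of_neg h2)

open scoped Matrix.Norms.Elementwise in
/-- There is a smallest subinvariance constant of a positive map. -/
lemma exists_min_subinvariant (hn : 0 < n)
    (hpos : ∀ T : Matrix (Fin n) (Fin n) ℂ, T.PosSemidef → (Θ T).PosSemidef) :
    ∃ (r : ℝ) (X : Matrix (Fin n) (Fin n) ℂ), X.PosSemidef ∧ X ≠ 0 ∧
      ((r : ℂ) • X - Θ X).PosSemidef ∧
      ∀ (c : ℝ) (Y : Matrix (Fin n) (Fin n) ℂ), Y.PosSemidef → Y ≠ 0 →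
        ((c : ℂ) • Y - Θ Y).PosSemidef → r ≤ c := by
  have : Nonempty (Fin n) := ⟨⟨0, hn⟩⟩
  have hnorm : ∀ {c : ℝ} {Y : Matrix (Fin n) (Fin n) ℂ}, Y.PosSemidef → Y ≠ 0 →
      ((c : ℂ) • Y - Θ Y).PosSemidef → ∃ Z : Matrix (Fin n) (Fin n) ℂ, Z.PosSemidef ∧ ‖Z‖ = 1 ∧
        ((c : ℂ) • Z - Θ Z).PosSemidef := by
    intro c Y hY hY0 hc
    have h0 : (0 : ℂ) ≤ ((‖Y‖⁻¹ : ℝ) : ℂ) := by exact_mod_cast inv_nonneg.2 (norm_nonneg Y)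
    refine ⟨((‖Y‖⁻¹ : ℝ) : ℂ) • Y, hY.smul h0, ?_, ?_⟩
    · rw [norm_smul, Complex.norm_real, norm_inv, norm_norm,
        inv_mul_cancel₀ (norm_ne_zero_iff.2 hY0)]
    · rw [map_smul, smul_comm, ← smul_sub]
      exact hc.smul h0
  obtain ⟨C, -, -, hC, -⟩ := PosDef.one.exists_smul_sub_posSemidef hn (hpos _ .one).1
  have hΘ : Continuous Θ := LinearMap.continuous_of_finiteDimensional Θ
  set K : Set (Matrix (Fin n) (Fin n) ℂ × ℝ) :=
    (Metric.sphere 0 1 ×ˢ Set.Icc 0 C) ∩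
      ({p | p.1.PosSemidef} ∩ {p | ((p.2 : ℂ) • p.1 - Θ p.1).PosSemidef}) with hK
  have hKc : IsCompact K := by
    refine ((isCompact_sphere _ _).prod isCompact_Icc).inter_right (.inter ?_ ?_)
    · exact isClosed_setOf_posSemidef.preimage continuous_fst
    · exact isClosed_setOf_posSemidef.preimage (by fun_prop)
  have hmem : ∀ {c : ℝ} {Y : Matrix (Fin n) (Fin n) ℂ}, Y.PosSemidef → Y ≠ 0 →
      ((c : ℂ) • Y - Θ Y).PosSemidef → c ≤ C → ∃ Z, (Z, c) ∈ K := by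
    intro c Y hY hY0 hc hcC
    obtain ⟨Z, hZ, hZ1, hZc⟩ := hnorm hY hY0 hc
    exact ⟨Z, ⟨by simpa using hZ1, nonneg_of_subinvariant hpos hY hY0 hc, hcC⟩, hZ, hZc⟩
  obtain ⟨Z, hZ⟩ := hmem .one one_ne_zero hC le_rfl
  obtain ⟨⟨X, r⟩, hX, hmin⟩ := hKc.exists_isMinOn ⟨_, hZ⟩ continuous_snd.continuousOn
  refine ⟨r, X, hX.2.1, ?_, hX.2.2, fun c Y hY hY0 hc => ?_⟩
  · rintro rfl
    simpa using hX.1.1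
  · rcases le_total c C with hcC | hcC
    · obtain ⟨Z, hZ⟩ := hmem hY hY0 hc hcC
      exact hmin hZ
    · exact hX.1.2.2.trans hcC

/-- An irreducible positive map has a positive definite eigenvector. -/
lemma IrreduciblePosMap.exists_posDef_eigenvector (hn : 0 < n)
    (hpos : ∀ T : Matrix (Fin n) (Fin n) ℂ, T.PosSemidef → (Θ T).PosSemidef)
    (hirr : IrreduciblePosMap Θ) :
    ∃ (r : ℝ) (X : Matrix (Fin n) (Fin n) ℂ), X.PosDef ∧ Θ X = (r : ℂ) • X := by
  obtain ⟨r, X, hX, hX0, hr, hmin⟩ := exists_min_subinvariant hn hpos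
  have hXd := hirr.posDef_of_subinvariant hn hpos hX hX0 hr
  refine ⟨r, X, hXd, ?_⟩
  by_contra hne
  obtain ⟨e, he⟩ := exists_resolvent_of_subinvariant hn hpos hXd hr (lt_add_one r)
  have hres : ∀ W : Matrix (Fin n) (Fin n) ℂ, W.PosSemidef → W ≠ 0 → (e.symm W).PosDef := by
    intro W hW hW0
    have hW' : (((r + 1 : ℝ) : ℂ) • e.symm W - Θ (e.symm W)).PosSemidef := by
      rwa [← he, e.apply_symm_apply]
    exact hirr.posDef_of_subinvariant hn hpos
      (posSemidef_of_resolvent_posSemidef hn hpos hXd hr (lt_add_one r) hW')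
      (by simpa using hW0) hW'
  set Z := e.symm X with hZ
  have hZd : Z.PosDef := hres X hX hX0
  have hYd := hres _ hr (sub_ne_zero.2 (Ne.symm hne))
  have hY : e.symm ((r : ℂ) • X - Θ X) = (r : ℂ) • Z - Θ Z := by
    rw [e.symm_apply_eq, he, map_sub, map_smul]
    have hXZ : X = ((r + 1 : ℝ) : ℂ) • Z - Θ Z := by rw [← he, e.apply_symm_apply]
    rw [hXZ, map_sub, map_smul]
    module
  rw [hY] at hYd
  obtain ⟨t, v, hv, ht, htv⟩ := hYd.exists_smul_sub_posSemidef hn hZd.1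
  have ht0 : 0 < t := by
    have h1 := hZd.reQuad_pos hv
    rw [htv] at h1
    exact pos_of_mul_pos_left h1 (hYd.reQuad_pos hv).le
  have h := ht.smul (a := ((t⁻¹ : ℝ) : ℂ)) (by exact_mod_cast (inv_pos.2 ht0).le)
  have h' : (((r - t⁻¹ : ℝ) : ℂ) • Z - Θ Z).PosSemidef := by
    convert h using 1
    rw [smul_sub, smul_smul, ← Complex.ofReal_mul, inv_mul_cancel₀ ht0.ne']
    push_cast
    module
  have hZ0 : Z ≠ 0 := by
    rintro h0
    rw [hZ, e.symm_apply_eq, map_zero] at h0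
    exact hX0 h0
  linarith [hmin _ Z hZd.posSemidef hZ0 h', inv_pos.2 ht0]

lemma IrreduciblePosMap.mem_span_of_eigenvector (hn : 0 < n)
    (hpos : ∀ T : Matrix (Fin n) (Fin n) ℂ, T.PosSemidef → (Θ T).PosSemidef)
    (hirr : IrreduciblePosMap Θ) {X : Matrix (Fin n) (Fin n) ℂ} (hX : X.PosDef) {r : ℝ}
    (hr : Θ X = (r : ℂ) • X) {Y : Matrix (Fin n) (Fin n) ℂ} (hY : Θ Y = (r : ℂ) • Y) :
    Y ∈ Submodule.span ℂ {X} := by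
  have key : ∀ H : Matrix (Fin n) (Fin n) ℂ, H.IsHermitian → Θ H = (r : ℂ) • H →
      H ∈ Submodule.span ℂ {X} := by
    intro H hH hΘH
    obtain ⟨t, v, hv, ht, htv⟩ := hX.exists_smul_sub_posSemidef hn hH
    have hz : (t : ℂ) • X - H = 0 := by
      by_contra h0
      have hd := hirr.posDef_of_subinvariant hn hpos ht h0 (c := r) (by
        rw [map_sub, map_smul, hr, hΘH, smul_comm, ← smul_sub, sub_self]
        exact .zero)
      have := hd.reQuad_pos hv
      rw [reQuad_sub, reQuad_smul, htv, sub_self] at this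
      exact this.false
    rw [← sub_eq_zero.1 hz]
    exact Submodule.smul_mem _ _ (Submodule.mem_span_singleton_self X)
  have hY' : Θ Yᴴ = (r : ℂ) • Yᴴ := by
    rw [map_conjTranspose_of_map_posSemidef hn hpos, hY]
    simp
  have h1 := key (Y + Yᴴ) (by simp [IsHermitian, add_comm]) (by rw [map_add, hY, hY', smul_add])
  have h2 := key (Complex.I • (Y - Yᴴ)) (by simp [IsHermitian, ← smul_neg])
    (by rw [map_smul, map_sub, hY, hY', ← smul_sub, smul_comm])
  rw [Submodule.smul_mem_iff _ Complex.I_ne_zero] at h2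
  have h3 := Submodule.add_mem _ h1 h2
  rwa [add_add_sub_cancel, ← two_smul ℂ Y, Submodule.smul_mem_iff _ two_ne_zero] at h3

/-- A positive map has no Jordan chain of length two over a positive definite eigenvector. -/
lemma eq_zero_of_map_eq_smul_add_smul (hn : 0 < n)
    (hpos : ∀ T : Matrix (Fin n) (Fin n) ℂ, T.PosSemidef → (Θ T).PosSemidef)
    {X : Matrix (Fin n) (Fin n) ℂ} (hX : X.PosDef) {r : ℝ}
    (hr : Θ X = (r : ℂ) • X) {Z : Matrix (Fin n) (Fin n) ℂ} {c : ℂ}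
    (hZ : Θ Z = (r : ℂ) • Z + c • X) : c = 0 := by
  have hle : ∀ (H : Matrix (Fin n) (Fin n) ℂ) (d : ℝ), H.IsHermitian →
      Θ H = (r : ℂ) • H + (d : ℂ) • X → d ≤ 0 := by
    intro H d hH hΘH
    obtain ⟨t, v, hv, ht, htv⟩ := hX.exists_smul_sub_posSemidef hn hH
    have h1 := (hpos _ ht).reQuad_nonneg v
    rw [map_sub, map_smul, hr, hΘH, reQuad_sub, reQuad_smul, reQuad_add, reQuad_smul, reQuad_smul,
      reQuad_smul, htv] at h1
    have h2 : d * reQuad X v ≤ 0 := by linarith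
    exact nonpos_of_mul_nonpos_left h2 (hX.reQuad_pos hv)
  have hzero : ∀ (H : Matrix (Fin n) (Fin n) ℂ) (d : ℝ), H.IsHermitian →
      Θ H = (r : ℂ) • H + (d : ℂ) • X → d = 0 := fun H d hH hΘH =>
    le_antisymm (hle H d hH hΘH) (neg_nonpos.1 (hle (-H) (-d) hH.neg (by
      rw [map_neg, hΘH, Complex.ofReal_neg]
      module)))
  have hZ' : Θ Zᴴ = (r : ℂ) • Zᴴ + (starRingEnd ℂ) c • X := by
    rw [map_conjTranspose_of_map_posSemidef hn hpos, hZ]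
    simp [hX.1.eq]
  have h1 := hzero (Z + Zᴴ) (2 * c.re) (by simp [IsHermitian, add_comm]) (by
    rw [map_add, hZ, hZ', ← Complex.add_conj]
    module)
  have h2 := hzero (Complex.I • (Z - Zᴴ)) (-(2 * c.im)) (by simp [IsHermitian, ← smul_neg]) (by
    have : ((-(2 * c.im) : ℝ) : ℂ) = Complex.I * (c - (starRingEnd ℂ) c) := by
      rw [Complex.sub_conj]
      push_cast
      linear_combination (-(2 * c.im) : ℂ) * Complex.I_mul_I
    rw [map_smul, map_sub, hZ, hZ', this]
    module)
  exact Complex.ext (by simpa using h1) (by simpa using h2)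

lemma IrreduciblePosMap.maxGenEigenspace_eq_span (hn : 0 < n)
    (hpos : ∀ T : Matrix (Fin n) (Fin n) ℂ, T.PosSemidef → (Θ T).PosSemidef)
    (hirr : IrreduciblePosMap Θ) {X : Matrix (Fin n) (Fin n) ℂ} (hX : X.PosDef) {r : ℝ}
    (hr : Θ X = (r : ℂ) • X) : Θ.maxGenEigenspace (r : ℂ) = Submodule.span ℂ {X} := by
  have hN : ∀ Y, (Θ - (r : ℂ) • (1 : Module.End ℂ (Matrix (Fin n) (Fin n) ℂ))) Y =
      Θ Y - (r : ℂ) • Y := fun Y => rfl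
  refine le_antisymm (fun Z hZ => ?_) ?_
  · obtain ⟨k, hk⟩ := (Module.End.mem_maxGenEigenspace _ _ _).1 hZ
    clear hZ
    suffices h : Θ Z = (r : ℂ) • Z from hirr.mem_span_of_eigenvector hn hpos hX hr h
    induction k generalizing Z with
    | zero =>
      rw [pow_zero, Module.End.one_apply] at hk
      simp [hk]
    | succ k ih =>
      rw [pow_succ, Module.End.mul_apply] at hk
      obtain ⟨c, hc⟩ := Submodule.mem_span_singleton.1
        (hirr.mem_span_of_eigenvector hn hpos hX hr (ih _ hk))
      rw [hN] at hc
      have hZ : Θ Z = (r : ℂ) • Z + c • X := by rw [hc, add_sub_cancel]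
      rw [hZ, eq_zero_of_map_eq_smul_add_smul hn hpos hX hr hZ, zero_smul, add_zero]
  · rw [Submodule.span_singleton_le_iff_mem, Module.End.mem_maxGenEigenspace]
    exact ⟨1, by rw [pow_one, hN, hr, sub_self]⟩

end PositiveMap

/-- A positive irreducible linear map on `Mₙ(ℂ)` has its spectral radius `r` as an eigenvalue
of algebraic multiplicity `1`. -/
theorem stmt_10 {n : ℕ} (hn : 0 < n)
    (Θ : Module.End ℂ (Matrix (Fin n) (Fin n) ℂ))
    (hpos : ∀ T : Matrix (Fin n) (Fin n) ℂ, T.PosSemidef → (Θ T).PosSemidef)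
    (hirr : IrreduciblePosMap Θ)
    (r : ℝ) (hr : r = sSup ((fun μ : ℂ => ‖μ‖) '' spectrum ℂ Θ)) :
    Module.End.HasEigenvalue Θ (r : ℂ) ∧
      Module.finrank ℂ (Θ.maxGenEigenspace (r : ℂ)) = 1 := by

  obtain ⟨ρ, X, hX, hρ⟩ := hirr.exists_posDef_eigenvector hn hpos
  have hX0 : X ≠ 0 := by
    rintro rfl
    simpa [Matrix.reQuad] using
      hX.reQuad_pos (v := fun _ => 1) fun h => one_ne_zero (congrFun h ⟨0, hn⟩)
  have heig : Θ.HasEigenvalue (ρ : ℂ) :=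
    Module.End.hasEigenvalue_of_hasEigenvector ⟨Module.End.mem_eigenspace_iff.2 hρ, hX0⟩
  have hsub : ((ρ : ℂ) • X - Θ X).PosSemidef := by
    rw [hρ, sub_self]
    exact .zero
  have hρ0 : 0 ≤ ρ := nonneg_of_subinvariant hpos hX.posSemidef hX0 hsub
  have hmax : IsGreatest ((fun μ : ℂ => ‖μ‖) '' spectrum ℂ Θ) ρ := by
    refine ⟨⟨ρ, heig.mem_spectrum, by simpa using hρ0⟩, ?_⟩
    rintro _ ⟨μ, hμ, rfl⟩
    obtain ⟨Y, hY⟩ := (Module.End.HasEigenvalue.of_mem_spectrum hμ).exists_hasEigenvector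
    exact norm_le_of_subinvariant hn hpos hX hsub hY.2 hY.apply_eq_smul
  rw [hmax.csSup_eq] at hr
  subst hr
  exact ⟨heig, by rw [hirr.maxGenEigenspace_eq_span hn hpos hX hρ, finrank_span_singleton hX0]⟩
end
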